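/- For every d ≥ 7, the d-dimensional crosspolytope is a nontile: there is no locally finite face-to-face tiling of ℝ^d by convex d-polytopes each combinatorially equivalent to the crosspolytope X_d = conv{±e_1, …, ±e_d}, the convex hull of the standard basis vectors and their negatives. -/

import Mathlib

open Set

noncomputable section

abbrev Euc (d : ℕ) := EuclideanSpace ℝ (Fin d)

/-- A tiling of `ℝ^d`: a family of closed sets covering the space with pairwise
disjoint interiors. -/
def IsTiling {d : ℕ} (𝒯 : Set (Set (Euc d))) : Prop :=
  (∀ T ∈ 𝒯, IsClosed T) ∧ ⋃₀ 𝒯 = Set.univ ∧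
    𝒯.Pairwise fun S T => interior S ∩ interior T = ∅

/-- Local finiteness: every compact set meets only finitely many tiles. -/
def LocallyFiniteTiling {d : ℕ} (𝒯 : Set (Set (Euc d))) : Prop :=
  ∀ K : Set (Euc d), IsCompact K → {T ∈ 𝒯 | (T ∩ K).Nonempty}.Finite

/-- `S` is an isometric copy of `T`. -/
def IsometricCopy {d : ℕ} (S T : Set (Euc d)) : Prop :=
  ∃ g : Euc d ≃ᵢ Euc d, g '' T = S

/-- A monohedral tiling with prototile `T`. -/
def Monohedral {d : ℕ} (𝒯 : Set (Set (Euc d))) (T : Set (Euc d)) : Prop :=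
  ∀ S ∈ 𝒯, IsometricCopy S T

/-- A convex `d`-polytope in `ℝ^d`: convex hull of a finite set, with nonempty interior. -/
def IsConvexPolytope {d : ℕ} (P : Set (Euc d)) : Prop :=
  (∃ V : Finset (Euc d), P = convexHull ℝ (V : Set (Euc d))) ∧ (interior P).Nonempty

/-- A tiling is face-to-face if the intersection of any two distinct tiles is a
face (extreme subset), possibly empty, of each of them. -/
def FaceToFace {d : ℕ} (𝒯 : Set (Set (Euc d))) : Prop :=
  ∀ S ∈ 𝒯, ∀ T ∈ 𝒯, S ≠ T → IsExtreme ℝ S (S ∩ T) ∧ IsExtreme ℝ T (S ∩ T)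

/-- Combinatorial equivalence: an order isomorphism between the face posets
(posets of extreme subsets ordered by inclusion). -/
def CombEquiv {d e : ℕ} (P : Set (Euc d)) (Q : Set (Euc e)) : Prop :=
  Nonempty ({F : Set (Euc d) // IsExtreme ℝ P F} ≃o {F : Set (Euc e) // IsExtreme ℝ Q F})

/-- A facet: a maximal proper nonempty face. -/
def IsFacet {d : ℕ} (Q F : Set (Euc d)) : Prop :=
  IsExtreme ℝ Q F ∧ F.Nonempty ∧ F ≠ Q ∧
    ∀ G : Set (Euc d), IsExtreme ℝ Q G → G ≠ Q → F ⊆ G → G = F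


/-- The `d`-dimensional crosspolytope `conv {±e₁, …, ±e_d}`. -/
def crossPolytope (d : ℕ) : Set (Euc d) :=
  convexHull ℝ ((Set.range fun i => EuclideanSpace.single i (1 : ℝ)) ∪
    (Set.range fun i => EuclideanSpace.single i (-1 : ℝ)))

section Extreme

variable {E : Type*} [AddCommGroup E] [Module ℝ E] {A B : Set E}

/-- A point with positive weight in a convex combination lying in an extreme set lies in that
extreme set. -/
lemma IsExtreme.mem_of_sum_mem {ι : Type*} (hA : Convex ℝ A) (hB : IsExtreme ℝ A B)
    {t : Finset ι} {w : ι → ℝ} {z : ι → E} (hw : ∀ i ∈ t, 0 ≤ w i) (hw1 : ∑ i ∈ t, w i = 1)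
    (hz : ∀ i ∈ t, z i ∈ A) (hx : ∑ i ∈ t, w i • z i ∈ B) {i : ι} (hi : i ∈ t)
    (hwi : 0 < w i) : z i ∈ B := by
  classical
  have hsum := Finset.add_sum_erase t w hi
  have hsum' := Finset.add_sum_erase t (fun i => w i • z i) hi
  have hnn : 0 ≤ ∑ j ∈ t.erase i, w j :=
    Finset.sum_nonneg fun j hj => hw j (Finset.mem_of_mem_erase hj)
  rcases hnn.eq_or_lt with h0 | hpos
  · have hz0 : ∀ j ∈ t.erase i, w j = 0 :=
      (Finset.sum_eq_zero_iff_of_nonneg fun j hj => hw j (Finset.mem_of_mem_erase hj)).1 h0.symm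
    have h1 : w i = 1 := by linarith
    have h2 : ∑ j ∈ t.erase i, w j • z j = 0 :=
      Finset.sum_eq_zero fun j hj => by rw [hz0 j hj, zero_smul]
    rw [← hsum', h2, h1] at hx
    simpa using hx
  · have hy : (t.erase i).centerMass w z ∈ A :=
      hA.centerMass_mem (fun j hj => hw j (Finset.mem_of_mem_erase hj)) hpos
        fun j hj => hz j (Finset.mem_of_mem_erase hj)
    refine hB.left_mem_of_mem_openSegment (hz i hi) hy hx
      ⟨w i, ∑ j ∈ t.erase i, w j, hwi, hpos, by linarith, ?_⟩
    rw [← hsum', Finset.centerMass, smul_smul, mul_inv_cancel₀ hpos.ne', one_smul]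

/-- A nonempty extreme subset of the convex hull of a finite set contains a point of that set. -/
lemma IsExtreme.exists_mem_of_convexHull {V : Set E} (hV : V.Finite)
    (hB : IsExtreme ℝ (convexHull ℝ V) B) (hne : B.Nonempty) : ∃ v ∈ V, v ∈ B := by
  obtain ⟨x, hx⟩ := hne
  have hxV := hB.subset hx
  lift V to Finset E using hV
  obtain ⟨w, hw, hw1, hwx⟩ := Finset.mem_convexHull'.1 hxV
  obtain ⟨v, hv, hpos⟩ : ∃ v ∈ V, 0 < w v := by
    by_contra! h
    have : ∑ v ∈ V, w v ≤ 0 := Finset.sum_nonpos h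
    linarith
  refine ⟨v, hv, hB.mem_of_sum_mem (convex_convexHull ℝ _) hw hw1
    (fun i hi => subset_convexHull ℝ _ hi) (z := id) ?_ hv hpos⟩
  simpa [hwx] using hx

lemma IsExtreme.iUnion {ι : Sort*} {F : ι → Set E} (hF : ∀ i, IsExtreme ℝ A (F i)) :
    IsExtreme ℝ A (⋃ i, F i) := by
  refine ⟨iUnion_subset fun i => (hF i).subset, fun x hx y hy z hz h => ?_⟩
  obtain ⟨i, hi⟩ := mem_iUnion.1 hz
  exact mem_iUnion.2 ⟨i, (hF i).left_mem_of_mem_openSegment hx hy hi h⟩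

lemma IsExtreme.empty : IsExtreme ℝ A (∅ : Set E) :=
  ⟨empty_subset _, fun _ _ _ _ _ hz => hz.elim⟩

lemma isExtreme_setOf_eq_of_le (f : E →ₗ[ℝ] ℝ) {c : ℝ} (hf : ∀ y ∈ A, f y ≤ c) :
    IsExtreme ℝ A {y ∈ A | f y = c} := by
  refine ⟨sep_subset _ _, fun x hx y hy z hz h => ⟨hx, ?_⟩⟩
  obtain ⟨a, b, ha, hb, hab, rfl⟩ := h
  have h1 := hz.2
  rw [map_add, map_smul, map_smul, smul_eq_mul, smul_eq_mul] at h1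
  have := hf x hx
  have h2 := hf y hy
  by_contra hne
  have hlt := lt_of_le_of_ne this hne
  have hc : c = a * c + b * c := by rw [← add_mul, hab, one_mul]
  nlinarith [mul_lt_mul_of_pos_left hlt ha, mul_le_mul_of_nonneg_left h2 hb.le]

/-- If every point of `A` can be reached by prolonging a segment from it through `x`,
then `A` is the only extreme subset containing `x`. -/
lemma IsExtreme.eq_of_forall_prolong {x : E} (hB : IsExtreme ℝ A B) (hx : x ∈ B)
    (h : ∀ y ∈ A, ∃ t : ℝ, 0 < t ∧ x + t • (x - y) ∈ A) : B = A := by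
  refine hB.subset.antisymm fun y hy => ?_
  obtain ⟨t, ht, hmem⟩ := h y hy
  refine hB.left_mem_of_mem_openSegment hy hmem hx ⟨t / (1 + t), 1 / (1 + t), by positivity,
    by positivity, by field_simp; ring, ?_⟩
  rw [smul_add, smul_smul, smul_sub, add_sub, sub_eq_add_neg, ← add_smul]
  have h1 : 1 / (1 + t) + 1 / (1 + t) * t = 1 := by field_simp
  have h2 : 1 / (1 + t) * t = t / (1 + t) := by field_simp
  rw [h1, h2, one_smul]
  abel

end Extreme

lemma IsExtreme.eq_of_mem_interior {E : Type*} [NormedAddCommGroup E] [NormedSpace ℝ E]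
    {A B : Set E} {x : E} (hB : IsExtreme ℝ A B) (hx : x ∈ B) (hxi : x ∈ interior A) : B = A := by
  refine hB.eq_of_forall_prolong hx fun y _ => ?_
  have hc : Filter.Tendsto (fun t : ℝ => x + t • (x - y)) (nhdsWithin 0 (Set.Ioi 0)) (nhds x) := by
    have : Continuous fun t : ℝ => x + t • (x - y) := by fun_prop
    simpa using (this.tendsto 0).mono_left nhdsWithin_le_nhds
  obtain ⟨t, ht, ht0⟩ := ((hc.eventually (mem_interior_iff_mem_nhds.1 hxi)).and
    self_mem_nhdsWithin).exists
  exact ⟨t, ht0, ht⟩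

namespace IsConvexPolytope

variable {d : ℕ} {P B : Set (Euc d)}

lemma convex (hP : IsConvexPolytope P) : Convex ℝ P := by
  obtain ⟨⟨V, rfl⟩, -⟩ := hP
  exact convex_convexHull ℝ _

lemma exists_singleton_subset (hP : IsConvexPolytope P) (hB : IsExtreme ℝ P B)
    (hne : B.Nonempty) : ∃ x ∈ B, IsExtreme ℝ P {x} := by
  obtain ⟨⟨V, hV⟩, -⟩ := hP
  have hfin : (P.extremePoints ℝ).Finite := by
    rw [hV]
    exact V.finite_toSet.subset extremePoints_convexHull_subset
  have hP : P = convexHull ℝ (P.extremePoints ℝ) := by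
    have := closure_convexHull_extremePoints (s := P)
      (by rw [hV]; exact V.finite_toSet.isCompact_convexHull ℝ)
      (by rw [hV]; exact convex_convexHull ℝ _)
    rwa [(hfin.isClosed_convexHull ℝ).closure_eq, eq_comm] at this
  obtain ⟨x, hx, hxB⟩ := IsExtreme.exists_mem_of_convexHull hfin (hP ▸ hB) hne
  exact ⟨x, hxB, isExtreme_singleton.2 hx⟩

end IsConvexPolytope

/-- The real sign attached to a Boolean. -/
def boolSign (b : Bool) : ℝ := if b then 1 else -1

lemma boolSign_mul_self (b : Bool) : boolSign b * boolSign b = 1 := by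
  cases b <;> simp [boolSign]

lemma abs_boolSign (b : Bool) : |boolSign b| = 1 := by
  cases b <;> simp [boolSign]

lemma exists_boolSign_mul_eq_abs (r : ℝ) : ∃ b, boolSign b * r = |r| := by
  rcases le_total 0 r with h | h
  · exact ⟨true, by simp [boolSign, abs_of_nonneg h]⟩
  · exact ⟨false, by simp [boolSign, abs_of_nonpos h]⟩

namespace crossPolytope

variable {d : ℕ}

/-- The vertex `±eᵢ` of the crosspolytope. -/
def vertex (i : Fin d) (b : Bool) : Euc d := EuclideanSpace.single i (boolSign b)

lemma eq_convexHull_range :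
    crossPolytope d = convexHull ℝ (Set.range fun k : Fin d × Bool => vertex k.1 k.2) := by
  unfold crossPolytope
  congr 1
  ext x
  constructor
  · rintro (⟨i, rfl⟩ | ⟨i, rfl⟩)
    · exact ⟨(i, true), by simp [vertex, boolSign]⟩
    · exact ⟨(i, false), by simp [vertex, boolSign]⟩
  · rintro ⟨⟨i, b⟩, rfl⟩
    cases b
    · exact Or.inr ⟨i, by simp [vertex, boolSign]⟩
    · exact Or.inl ⟨i, by simp [vertex, boolSign]⟩

lemma vertex_mem (i : Fin d) (b : Bool) : vertex i b ∈ crossPolytope d := by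
  rw [eq_convexHull_range]
  exact subset_convexHull ℝ _ ⟨(i, b), rfl⟩

/-- The linear functional `x ↦ ∑ ±xᵢ`. -/
def signFunctional (σ : Fin d → Bool) : Euc d →ₗ[ℝ] ℝ :=
  ∑ i, boolSign (σ i) • (EuclideanSpace.proj i : Euc d →L[ℝ] ℝ).toLinearMap

lemma signFunctional_apply (σ : Fin d → Bool) (x : Euc d) :
    signFunctional σ x = ∑ i, boolSign (σ i) * x i := by
  simp [signFunctional]

lemma signFunctional_vertex (σ : Fin d → Bool) (i : Fin d) (b : Bool) :
    signFunctional σ (vertex i b) = boolSign (σ i) * boolSign b := by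
  rw [signFunctional_apply, Finset.sum_eq_single i] <;> simp +contextual [vertex]

lemma signFunctional_le_one (σ : Fin d → Bool) {x : Euc d} (hx : x ∈ crossPolytope d) :
    signFunctional σ x ≤ 1 := by
  rw [eq_convexHull_range] at hx
  refine convexHull_min ?_ (convex_halfSpace_le (signFunctional σ).isLinear 1) hx
  rintro _ ⟨⟨i, b⟩, rfl⟩
  change signFunctional σ (vertex i b) ≤ 1
  rw [signFunctional_vertex, ← one_mul (1 : ℝ)]
  cases b <;> cases σ i <;> norm_num [boolSign]

lemma exists_signFunctional_eq (x : Euc d) : ∃ σ, signFunctional σ x = ∑ i, |x i| := by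
  choose σ hσ using fun i => exists_boolSign_mul_eq_abs (x i)
  exact ⟨σ, by simp_rw [signFunctional_apply, hσ]⟩

lemma sum_abs_le_one {x : Euc d} (hx : x ∈ crossPolytope d) : ∑ i, |x i| ≤ 1 := by
  obtain ⟨σ, hσ⟩ := exists_signFunctional_eq x
  exact hσ ▸ signFunctional_le_one σ hx

lemma sum_smul_vertex (w : Fin d → Bool → ℝ) :
    ∑ k : Fin d × Bool, w k.1 k.2 • vertex k.1 k.2 =
      WithLp.toLp 2 fun i => w i true - w i false := by
  ext j
  rw [Fintype.sum_prod_type]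
  simp only [Fintype.sum_bool, WithLp.ofLp_sum, Finset.sum_apply]
  rw [Finset.sum_eq_single j]
  · simp [vertex, boolSign, sub_eq_add_neg]
  · intro i _ hij
    simp [vertex, hij.symm]
  · simp

lemma mem_of_sum_abs_le_one (hd : d ≠ 0) {x : Euc d} (hx : ∑ i, |x i| ≤ 1) :
    x ∈ crossPolytope d := by
  have hd' : (0 : ℝ) < d := by positivity
  set s : ℝ := 1 - ∑ i, |x i| with hs
  let w : Fin d → Bool → ℝ := fun i b => (|x i| + boolSign b * x i) / 2 + s / (2 * d)
  have hxw : x = ∑ k : Fin d × Bool, w k.1 k.2 • vertex k.1 k.2 := by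
    rw [sum_smul_vertex]
    ext i
    simp only [w, boolSign]
    simp
    ring
  rw [hxw, eq_convexHull_range]
  refine (convex_convexHull ℝ _).sum_mem (fun k _ => ?_) ?_
    fun k _ => subset_convexHull ℝ _ ⟨k, rfl⟩
  · have h1 : -(boolSign k.2 * x k.1) ≤ |x k.1| := by
      have := neg_le_abs (boolSign k.2 * x k.1)
      rwa [abs_mul, abs_boolSign, one_mul] at this
    have h2 : 0 ≤ s / (2 * d) := by
      have : 0 ≤ s := by linarith
      positivity
    simp only [w]
    linarith
  · rw [Fintype.sum_prod_type]
    simp only [Fintype.sum_bool]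
    have : ∀ i : Fin d, w i true + w i false = |x i| + s / d := by
      intro i
      simp [w, boolSign]
      ring
    rw [Finset.sum_congr rfl fun i _ => this i, Finset.sum_add_distrib]
    simp only [Finset.sum_const, Finset.card_univ, Fintype.card_fin, nsmul_eq_mul]
    field_simp
    linarith

/-- The facet of the crosspolytope given by a sign vector. -/
def facet (σ : Fin d → Bool) : Set (Euc d) :=
  {x ∈ crossPolytope d | signFunctional σ x = 1}

lemma isExtreme_facet (σ : Fin d → Bool) : IsExtreme ℝ (crossPolytope d) (facet σ) :=
  isExtreme_setOf_eq_of_le _ fun _ hy => signFunctional_le_one σ hy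

lemma vertex_mem_facet (σ : Fin d → Bool) (i : Fin d) (b : Bool) :
    vertex i b ∈ facet σ ↔ b = σ i := by
  have : vertex i b ∈ facet σ ↔ boolSign (σ i) * boolSign b = 1 := by
    rw [← signFunctional_vertex]
    exact and_iff_right (vertex_mem i b)
  rw [this]
  cases b <;> cases σ i <;> norm_num [boolSign]

lemma isExtreme_vertex (i : Fin d) (b : Bool) :
    IsExtreme ℝ (crossPolytope d) {vertex i b} := by
  have hset : {vertex i b} = {x ∈ crossPolytope d |
      (boolSign b • (EuclideanSpace.proj i : Euc d →L[ℝ] ℝ).toLinearMap) x = 1} := by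
    ext x
    rw [Set.mem_singleton_iff]
    constructor
    · rintro rfl
      exact ⟨vertex_mem i b, by simp [vertex, boolSign_mul_self]⟩
    · rintro ⟨hx, h1⟩
      replace h1 : boolSign b * x i = 1 := by simpa using h1
      have h2 : x i = boolSign b := by
        rw [← one_mul (x i), ← boolSign_mul_self b, mul_assoc, h1, mul_one]
      have h3 := sum_abs_le_one hx
      rw [← Finset.add_sum_erase _ _ (Finset.mem_univ i), h2, abs_boolSign] at h3
      have h4 : ∑ j ∈ Finset.univ.erase i, |x j| = 0 :=
        le_antisymm (by linarith) (Finset.sum_nonneg fun j _ => abs_nonneg _)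
      rw [Finset.sum_eq_zero_iff_of_nonneg fun j _ => abs_nonneg _] at h4
      ext j
      by_cases hj : j = i
      · subst hj
        simp [vertex, h2]
      · simpa [vertex, hj] using h4 j (by simp [hj])
  rw [hset]
  refine isExtreme_setOf_eq_of_le _ fun y hy => ?_
  have h1 : |y i| ≤ ∑ j, |y j| :=
    Finset.single_le_sum (f := fun j => |y j|) (fun j _ => abs_nonneg _) (Finset.mem_univ i)
  have h2 := le_abs_self (boolSign b * y i)
  rw [abs_mul, abs_boolSign, one_mul] at h2
  have h3 := sum_abs_le_one hy
  simpa using h2.trans (h1.trans h3)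

lemma exists_vertex_mem {B : Set (Euc d)} (hB : IsExtreme ℝ (crossPolytope d) B)
    (hne : B.Nonempty) : ∃ i b, vertex i b ∈ B := by
  rw [eq_convexHull_range] at hB
  obtain ⟨_, ⟨⟨i, b⟩, rfl⟩, hv⟩ := hB.exists_mem_of_convexHull (Set.finite_range _) hne
  exact ⟨i, b, hv⟩

lemma eq_or_subset_iUnion_facet (hd : d ≠ 0) {B : Set (Euc d)}
    (hB : IsExtreme ℝ (crossPolytope d) B) : B = crossPolytope d ∨ B ⊆ ⋃ σ, facet σ := by
  by_contra! h
  obtain ⟨y, hyB, hy⟩ := Set.not_subset.1 h.2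
  refine h.1 (hB.eq_of_forall_prolong hyB fun x hx => ?_)
  obtain ⟨σ, hσ⟩ := exists_signFunctional_eq y
  have hlt : ∑ i, |y i| < 1 :=
    lt_of_le_of_ne (sum_abs_le_one (hB.subset hyB)) fun h1 =>
      hy (mem_iUnion.2 ⟨σ, hB.subset hyB, hσ.trans h1⟩)
  set Y := ∑ i, |y i| with hY
  refine ⟨(1 - Y) / 2, by linarith, mem_of_sum_abs_le_one hd ?_⟩
  have hX := sum_abs_le_one hx
  have hY0 : 0 ≤ Y := Finset.sum_nonneg fun _ _ => abs_nonneg _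
  have hle : ∀ i, |(y + ((1 - Y) / 2) • (y - x)) i| ≤
      |y i| + (1 - Y) / 2 * |y i| + (1 - Y) / 2 * |x i| := by
    intro i
    have ht : 0 ≤ (1 - Y) / 2 := by linarith
    have h1 : (y + ((1 - Y) / 2) • (y - x)) i =
      y i + (1 - Y) / 2 * y i + -((1 - Y) / 2 * x i) := by
      simp
      ring
    rw [h1]
    refine (abs_add_le _ _).trans (add_le_add ((abs_add_le _ _).trans_eq ?_) ?_)
    · rw [abs_mul, abs_of_nonneg ht]
    · rw [abs_neg, abs_mul, abs_of_nonneg ht]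
  refine (Finset.sum_le_sum fun i _ => hle i).trans ?_
  rw [Finset.sum_add_distrib, Finset.sum_add_distrib, ← Finset.mul_sum, ← Finset.mul_sum, ← hY]
  nlinarith

lemma exists_generic_mem_facet (hd : d ≠ 0) (σ : Fin d → Bool) :
    ∃ z ∈ facet σ, ∀ B, IsExtreme ℝ (crossPolytope d) B → z ∈ B → facet σ ⊆ B := by
  have hd' : (0 : ℝ) < d := by positivity
  have hpos : ∀ x : Euc d, (∀ i, 0 ≤ boolSign (σ i) * x i) → signFunctional σ x = 1 →
      x ∈ crossPolytope d := by
    intro x hx h1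
    refine mem_of_sum_abs_le_one hd (h1 ▸ le_of_eq ?_)
    rw [signFunctional_apply]
    refine Finset.sum_congr rfl fun i _ => ?_
    rw [← abs_of_nonneg (hx i), abs_mul, abs_boolSign, one_mul]
  let z : Euc d := WithLp.toLp 2 fun i => boolSign (σ i) / d
  have hzi : ∀ i, boolSign (σ i) * z i = 1 / d := by
    intro i
    simp only [z]
    rw [← mul_div_assoc, boolSign_mul_self]
  have hz1 : signFunctional σ z = 1 := by
    rw [signFunctional_apply, Finset.sum_congr rfl fun i _ => hzi i]
    simp [hd]
  refine ⟨z, ⟨hpos z (fun i => by rw [hzi]; positivity) hz1, hz1⟩, fun B hB hzB x hx => ?_⟩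
  have hBF : IsExtreme ℝ (facet σ) (B ∩ facet σ) :=
    (hB.inter (isExtreme_facet σ)).mono (isExtreme_facet σ).subset Set.inter_subset_right
  have hz : z ∈ B ∩ facet σ :=
    ⟨hzB, hpos z (fun i => by rw [hzi]; positivity) hz1, hz1⟩
  have hBF' := hBF.eq_of_forall_prolong hz fun y hy => by
    refine ⟨1 / d, by positivity, ?_⟩
    have h1 : signFunctional σ (z + (1 / (d : ℝ)) • (z - y)) = 1 := by
      rw [map_add, map_smul, map_sub, hz1, hy.2]
      simp
    refine ⟨hpos _ (fun i => ?_) h1, h1⟩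
    have h2 : boolSign (σ i) * y i ≤ 1 := by
      refine (le_abs_self _).trans ?_
      rw [abs_mul, abs_boolSign, one_mul]
      exact (Finset.single_le_sum (f := fun j => |y j|) (fun j _ => abs_nonneg _)
        (Finset.mem_univ i)).trans (sum_abs_le_one hy.1)
    have h3 : boolSign (σ i) * (z + (1 / (d : ℝ)) • (z - y)) i =
        1 / d + 1 / d * (1 / d) - 1 / d * (boolSign (σ i) * y i) := by
      rw [← hzi i]
      simp
      ring
    rw [h3]
    have h4 : 1 / (d : ℝ) * (boolSign (σ i) * y i) ≤ 1 / d * 1 :=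
      mul_le_mul_of_nonneg_left h2 (by positivity)
    have h5 : 0 ≤ 1 / (d : ℝ) * (1 / d) := by positivity
    linarith
  exact (hBF'.symm ▸ hx : x ∈ B ∩ facet σ).1

end crossPolytope

/-- A labelling of the vertices of a convex polytope `T` witnessing that `T` has the face structure
of a crosspolytope: `u i true` and `u i false` are antipodal vertices. -/
structure CrossLabelling {d : ℕ} (T : Set (Euc d)) (u : Fin d → Bool → Euc d) : Prop where
  convex : Convex ℝ T
  vertex : ∀ i b, IsExtreme ℝ T {u i b}
  exists_eq_of_vertex : ∀ x, IsExtreme ℝ T {x} → ∃ i b, x = u i b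
  eq_of_antipodal_mem : ∀ B, IsExtreme ℝ T B → Convex ℝ B → ∀ i, u i true ∈ B → u i false ∈ B →
    B = T
  facet : ∀ σ : Fin d → Bool, ∃ ν : Euc d →ₗ[ℝ] ℝ, ∃ x ∈ T, (∀ y ∈ T, ν y ≤ ν x) ∧
    (∃ y : ℕ → Euc d, Filter.Tendsto y Filter.atTop (nhds x) ∧ ∀ m, ν x < ν (y m)) ∧
    (∀ i, ν (u i (σ i)) = ν x) ∧ (∀ i, ν (u i (!σ i)) < ν x) ∧
    ∀ B, IsExtreme ℝ T B → x ∈ B → ∀ i, u i (σ i) ∈ B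

section FacePoset

variable {E E' : Type*} [AddCommGroup E] [Module ℝ E] [AddCommGroup E'] [Module ℝ E']
  {P : Set E} {Q : Set E'}

lemma FacePoset.subset_iUnion
    (Φ : {F : Set E // IsExtreme ℝ P F} ≃o {F : Set E' // IsExtreme ℝ Q F}) {ι : Sort*}
    (F : ι → {F : Set E // IsExtreme ℝ P F}) {B : {F : Set E // IsExtreme ℝ P F}}
    (hB : B.1 ⊆ ⋃ i, (F i).1) : (Φ B).1 ⊆ ⋃ i, (Φ (F i)).1 := by
  let U : {F : Set E' // IsExtreme ℝ Q F} :=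
    ⟨⋃ i, (Φ (F i)).1, IsExtreme.iUnion fun i => (Φ (F i)).2⟩
  have h1 : ∀ i, F i ≤ Φ.symm U := fun i =>
    (Φ.le_symm_apply).2 (Set.subset_iUnion (fun i => (Φ (F i)).1) i)
  have h2 : B ≤ Φ.symm U := hB.trans (Set.iUnion_subset h1)
  exact (Φ.le_symm_apply).1 h2

lemma FacePoset.nonempty
    (Φ : {F : Set E // IsExtreme ℝ P F} ≃o {F : Set E' // IsExtreme ℝ Q F})
    {B : {F : Set E // IsExtreme ℝ P F}} (hB : B.1.Nonempty) : (Φ B).1.Nonempty := by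
  by_contra h
  rw [Set.not_nonempty_iff_eq_empty] at h
  have h1 : Φ B ≤ Φ ⟨∅, IsExtreme.empty⟩ := by
    change (Φ B).1 ⊆ _
    rw [h]
    exact Set.empty_subset _
  have h2 : B.1 ⊆ ∅ := (Φ.le_iff_le).1 h1
  exact hB.ne_empty (Set.subset_empty_iff.1 h2)

end FacePoset

lemma IsConvexPolytope.exists_crossLabelling {d : ℕ} (hd : d ≠ 0) {T : Set (Euc d)}
    (hT : IsConvexPolytope T) (hC : CombEquiv T (crossPolytope d)) :
    ∃ u, CrossLabelling T u := by
  obtain ⟨Φ⟩ := hC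
  have hvert : ∀ i b, ∃ x, ∃ hx : IsExtreme ℝ T {x},
      (Φ ⟨{x}, hx⟩).1 = {crossPolytope.vertex i b} := by
    intro i b
    let V : {F : Set (Euc d) // IsExtreme ℝ (crossPolytope d) F} :=
      ⟨_, crossPolytope.isExtreme_vertex i b⟩
    obtain ⟨x, hxV, hx⟩ := hT.exists_singleton_subset (Φ.symm V).2
      (FacePoset.nonempty Φ.symm (Set.singleton_nonempty _))
    refine ⟨x, hx, ?_⟩
    have h1 : (Φ ⟨{x}, hx⟩) ≤ V :=
      Φ.le_symm_apply.1 (show ({x} : Set (Euc d)) ⊆ _ from Set.singleton_subset_iff.2 hxV)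
    exact (Set.subset_singleton_iff_eq.1 h1).resolve_left
      (FacePoset.nonempty Φ (B := ⟨{x}, hx⟩) (Set.singleton_nonempty _)).ne_empty
  choose u hu huv using hvert
  have hmem : ∀ i b (B : {F : Set (Euc d) // IsExtreme ℝ T F}),
      u i b ∈ B.1 ↔ crossPolytope.vertex i b ∈ (Φ B).1 := by
    intro i b B
    have : (⟨{u i b}, hu i b⟩ : {F : Set (Euc d) // IsExtreme ℝ T F}) ≤ B ↔ _ :=
      (Φ.le_iff_le).symm
    rw [← Set.singleton_subset_iff, ← Set.singleton_subset_iff, ← huv i b]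
    exact this
  let A : (Fin d → Bool) → {F : Set (Euc d) // IsExtreme ℝ T F} := fun σ =>
    Φ.symm ⟨_, crossPolytope.isExtreme_facet σ⟩
  have hA : ∀ σ i b, u i b ∈ (A σ).1 ↔ b = σ i := by
    intro σ i b
    rw [hmem, OrderIso.apply_symm_apply]
    exact crossPolytope.vertex_mem_facet σ i b
  have hcover : ∀ B, IsExtreme ℝ T B → B = T ∨ B ⊆ ⋃ σ, (A σ).1 := by
    intro B hB
    rcases crossPolytope.eq_or_subset_iUnion_facet hd (Φ ⟨B, hB⟩).2 with h | h
    · left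
      have h1 : Φ ⟨T, IsExtreme.rfl⟩ ≤ Φ ⟨B, hB⟩ := by
        change (Φ ⟨T, IsExtreme.rfl⟩).1 ⊆ (Φ ⟨B, hB⟩).1
        rw [h]
        exact (Φ ⟨T, IsExtreme.rfl⟩).2.subset
      exact hB.subset.antisymm (Φ.le_iff_le.1 h1)
    · right
      have := FacePoset.subset_iUnion Φ.symm
        (fun σ => ⟨_, crossPolytope.isExtreme_facet σ⟩) h
      rwa [OrderIso.symm_apply_apply] at this
  have hanti : ∀ B, IsExtreme ℝ T B → Convex ℝ B → ∀ i, u i true ∈ B → u i false ∈ B →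
      B = T := by
    intro B hB hBc i h1 h2
    refine (hcover B hB).resolve_right fun h => ?_
    have hm : (2⁻¹ : ℝ) • u i true + (2⁻¹ : ℝ) • u i false ∈ B :=
      hBc h1 h2 (by norm_num) (by norm_num) (by norm_num)
    obtain ⟨σ, hσ⟩ := mem_iUnion.1 (h hm)
    have hseg : (2⁻¹ : ℝ) • u i true + (2⁻¹ : ℝ) • u i false ∈
        openSegment ℝ (u i true) (u i false) :=
      ⟨2⁻¹, 2⁻¹, by norm_num, by norm_num, by norm_num, rfl⟩
    have h3 := (hA σ i true).1
      ((A σ).2.left_mem_of_mem_openSegment (hB.subset h1) (hB.subset h2) hσ hseg)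
    have h4 := (hA σ i false).1
      ((A σ).2.right_mem_of_mem_openSegment (hB.subset h1) (hB.subset h2) hσ hseg)
    simp [← h3] at h4
  have hgen : ∀ σ, ∃ x ∈ (A σ).1, ∀ B, IsExtreme ℝ T B → x ∈ B → (A σ).1 ⊆ B := by
    intro σ
    by_contra! h
    choose F hF hxF hFA using h
    obtain ⟨z, hz, hzB⟩ := crossPolytope.exists_generic_mem_facet hd σ
    have hsub : (A σ).1 ⊆ ⋃ p : (A σ).1, F p.1 p.2 := fun x hx =>
      mem_iUnion.2 ⟨⟨x, hx⟩, hxF x hx⟩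
    have h1 := FacePoset.subset_iUnion Φ (fun p : (A σ).1 => ⟨F p.1 p.2, hF p.1 p.2⟩) hsub
    rw [OrderIso.apply_symm_apply] at h1
    obtain ⟨p, hp⟩ := mem_iUnion.1 (h1 hz)
    refine hFA p.1 p.2 ?_
    have h2 : (⟨_, crossPolytope.isExtreme_facet σ⟩ :
        {F : Set (Euc d) // IsExtreme ℝ (crossPolytope d) F}) ≤ Φ ⟨F p.1 p.2, hF p.1 p.2⟩ :=
      hzB _ (Φ ⟨F p.1 p.2, hF p.1 p.2⟩).2 hp
    exact Φ.symm_apply_le.2 h2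
  have hTc := hT.convex
  refine ⟨u, hTc, hu, ?_, hanti, ?_⟩
  · intro x hx
    obtain ⟨i, b, h⟩ := crossPolytope.exists_vertex_mem (Φ ⟨{x}, hx⟩).2
      (FacePoset.nonempty Φ (B := ⟨{x}, hx⟩) (Set.singleton_nonempty _))
    exact ⟨i, b, ((hmem i b ⟨{x}, hx⟩).2 h).symm⟩
  · intro σ
    obtain ⟨x, hx, hxA⟩ := hgen σ
    have hxT : x ∈ T := (A σ).2.subset hx
    have hxi : x ∉ interior T := by
      intro hi
      have h1 := (A σ).2.eq_of_mem_interior hx hi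
      have h2 : u ⟨0, Nat.pos_of_ne_zero hd⟩ (!σ ⟨0, Nat.pos_of_ne_zero hd⟩) ∈ (A σ).1 := by
        rw [h1]
        exact (hu _ _).subset rfl
      have h3 := (hA _ _ _).1 h2
      simp at h3
    obtain ⟨f, hf⟩ := geometric_hahn_banach_open_point hTc.interior isOpen_interior hxi
    have hfT : ∀ y ∈ T, f y ≤ f x := by
      intro y hy
      have hcl : y ∈ closure (interior T) := by
        rw [hTc.closure_interior_eq_closure_of_nonempty_interior hT.2]
        exact subset_closure hy
      exact closure_minimal (fun a ha => (hf a ha).le)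
        (isClosed_le f.continuous continuous_const) hcl
    obtain ⟨c, hc⟩ := hT.2
    have hfc := hf c hc
    have hE : IsExtreme ℝ T {y ∈ T | f.toLinearMap y = f x} := isExtreme_setOf_eq_of_le _ hfT
    have hEc : Convex ℝ {y ∈ T | f.toLinearMap y = f x} :=
      hTc.inter (convex_hyperplane f.toLinearMap.isLinear _)
    have hET : {y ∈ T | f.toLinearMap y = f x} ≠ T := by
      intro h
      have h1 : c ∈ {y ∈ T | f.toLinearMap y = f x} := by
        rw [h]
        exact interior_subset hc
      exact hfc.ne h1.2
    have hin : ∀ i, u i (σ i) ∈ {y ∈ T | f.toLinearMap y = f x} := fun i =>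
      hxA _ hE ⟨hxT, rfl⟩ ((hA σ i _).2 rfl)
    refine ⟨f.toLinearMap, x, hxT, hfT, ?_, fun i => (hin i).2, fun i => ?_,
      fun B hB hxB i => hxA B hB hxB ((hA σ i _).2 rfl)⟩
    · refine ⟨fun m => x + (1 / ((m : ℝ) + 1)) • (x - c), ?_, fun m => ?_⟩
      · have h1 := (tendsto_one_div_add_atTop_nhds_zero_nat (𝕜 := ℝ)).smul_const (x - c)
        simpa using h1.const_add x
      · have : 0 < 1 / ((m : ℝ) + 1) := by positivity
        simp only [ContinuousLinearMap.coe_coe, map_add, map_smul, map_sub, smul_eq_mul]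
        nlinarith
    · have hmT : u i (!σ i) ∈ T := (hu i _).subset rfl
      refine lt_of_le_of_ne (hfT _ hmT) fun heq => hET ?_
      have h1 : u i (!σ i) ∈ {y ∈ T | f.toLinearMap y = f x} := ⟨hmT, heq⟩
      have h2 := hin i
      cases hb : σ i
      · rw [hb] at h1 h2
        exact hanti _ hE hEc i h1 h2
      · rw [hb] at h1 h2
        exact hanti _ hE hEc i h2 h1

lemma three_mul_centralBinom_lt {k : ℕ} (hk : 3 ≤ k) : 3 * k.centralBinom < 4 ^ k := by
  induction k, hk using Nat.le_induction with
  | base => decide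
  | succ k hk ih =>
    have h := Nat.succ_mul_centralBinom_succ k
    rw [pow_succ]
    by_contra! hcon
    have h1 : (k + 1) * (4 ^ k * 4) ≤ (k + 1) * (3 * (k + 1).centralBinom) :=
      Nat.mul_le_mul_left _ hcon
    nlinarith

lemma sum_choose_mul_two_mul_sub {n m : ℕ} (hm : n < 2 * m) (hm' : 2 * m ≤ n + 2)
    {j : ℕ} (hj : m ≤ j) (hjn : j ≤ n + 1) :
    ∑ k ∈ Finset.range j, n.choose k * (2 * k - n) + n.choose j * j = n.choose m * m := by
  induction j, hj using Nat.le_induction with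
  | base =>
    rw [Finset.sum_eq_zero, zero_add]
    intro k hk
    have : 2 * k - n = 0 := by have := Finset.mem_range.1 hk; omega
    rw [this, mul_zero]
  | succ j hj ih =>
    rw [← ih (by omega), Finset.sum_range_succ, Nat.choose_succ_right_eq, add_assoc, ← mul_add]
    congr 2
    omega

lemma three_mul_sum_powerset_lt {n : ℕ} (hn : 6 ≤ n) :
    6 * ∑ K : Finset (Fin n), (2 * K.card - n) < n * 2 ^ n := by
  have h1 : ∑ K : Finset (Fin n), (2 * K.card - n) =
      ∑ k ∈ Finset.range (n + 1), n.choose k * (2 * k - n) := by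
    rw [← Finset.powerset_univ, Finset.sum_powerset_apply_card (fun k => 2 * k - n)]
    simp
  have h2 := sum_choose_mul_two_mul_sub (n := n) (m := n / 2 + 1) (by omega) (by omega)
    (j := n + 1) (by omega) le_rfl
  rw [Nat.choose_succ_self, zero_mul, add_zero] at h2
  rw [h1, h2]
  have hk := three_mul_centralBinom_lt (k := n / 2) (by omega)
  set k := n / 2 with hkdef
  rw [Nat.centralBinom_eq_two_mul_choose] at hk
  rw [Nat.choose_succ_right_eq]
  have h4 : (4 : ℕ) ^ k = 2 ^ (2 * k) := by rw [pow_mul]; norm_num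
  rw [h4] at hk
  rcases (by omega : n = 2 * k ∨ n = 2 * k + 1) with h | h
  · rw [h]
    have : 2 * k - k = k := by omega
    rw [this]
    nlinarith
  · have h5 : n.choose k * (n - k) = (2 * k).choose k * (2 * k + 1) := by
      have h6 := Nat.choose_mul_succ_eq (2 * k) k
      rw [h, h6]
    rw [h5, h, pow_succ]
    nlinarith

/-- Flip one coordinate of a sign vector. -/
def flipAt {n : ℕ} (σ : Fin n → Bool) (j : Fin n) : Fin n → Bool := Function.update σ j (!σ j)

lemma flipAt_same {n : ℕ} (σ : Fin n → Bool) (j : Fin n) : flipAt σ j j = !σ j := by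
  simp [flipAt]

lemma flipAt_of_ne {n : ℕ} (σ : Fin n → Bool) {i j : Fin n} (h : i ≠ j) :
    flipAt σ j i = σ i := by
  simp [flipAt, h]

lemma flipAt_flipAt {n : ℕ} (σ : Fin n → Bool) (j : Fin n) : flipAt (flipAt σ j) j = σ := by
  simp [flipAt]

/-- Flipping as a permutation of the pairs of a sign vector and a coordinate. -/
def flipPerm (n : ℕ) : Equiv.Perm ((Fin n → Bool) × Fin n) where
  toFun x := (flipAt x.1 x.2, x.2)
  invFun x := (flipAt x.1 x.2, x.2)
  left_inv x := by simp [flipAt_flipAt]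
  right_inv x := by simp [flipAt_flipAt]

lemma card_filter_flip {n : ℕ} (p : (Fin n → Bool) × Fin n → Prop) [DecidablePred p] :
    (Finset.univ.filter fun x => p (flipPerm n x)).card = (Finset.univ.filter p).card :=
  Finset.card_equiv (flipPerm n) (by simp)

/-- If every subcube has exactly one vertex whose outmap contains all of its directions, the
outmap is a bijection. -/
lemma bijective_of_unique_sink {n : ℕ} (D : (Fin n → Bool) → Finset (Fin n))
    (hD : ∀ (J : Finset (Fin n)) (τ : Fin n → Bool), ∃! σ, (∀ i ∉ J, σ i = τ i) ∧ J ⊆ D σ) :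
    Function.Bijective D := by
  classical
  have hcount : ∀ J : Finset (Fin n),
      (Finset.univ.filter fun σ => J ⊆ D σ).card = 2 ^ (n - J.card) := by
    intro J
    have hbij : Function.Bijective fun (σ : {σ // J ⊆ D σ}) (i : {i // i ∉ J}) => σ.1 i := by
      constructor
      · intro σ σ' h
        obtain ⟨_, -, huniq⟩ := hD J σ.1
        apply Subtype.ext
        rw [huniq σ.1 ⟨fun _ _ => rfl, σ.2⟩,
          huniq σ'.1 ⟨fun i hi => (congrFun h ⟨i, hi⟩).symm, σ'.2⟩]
      · intro τ
        obtain ⟨σ, ⟨h1, h2⟩, -⟩ := hD J fun i => if h : i ∈ J then true else τ ⟨i, h⟩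
        refine ⟨⟨σ, h2⟩, funext fun i => ?_⟩
        simpa [i.2] using h1 i.1 i.2
    have h1 := Fintype.card_of_bijective hbij
    rw [Fintype.card_subtype] at h1
    rw [h1, Fintype.card_fun, Fintype.card_bool, Fintype.card_subtype_compl]
    simp
  have hone : ∀ k, ∀ J : Finset (Fin n), n - J.card = k →
      (Finset.univ.filter fun σ => D σ = J).card = 1 := by
    intro k
    induction k using Nat.strong_induction_on with
    | _ k ih =>
    intro J hJ
    have h1 := hcount J
    rw [Finset.card_eq_sum_card_fiberwise (f := D) (t := Finset.Icc J Finset.univ)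
      (fun σ hσ => by simpa using hσ)] at h1
    have h2 : ∀ K ∈ Finset.Icc J Finset.univ,
        ((Finset.univ.filter fun σ => J ⊆ D σ).filter fun σ => D σ = K).card =
          (Finset.univ.filter fun σ => D σ = K).card := by
      intro K hK
      congr 1
      ext σ
      have := (Finset.mem_Icc.1 hK).1
      simp only [Finset.mem_filter, Finset.mem_univ, true_and]
      exact ⟨fun h => h.2, fun h => ⟨h ▸ this, h⟩⟩
    have hmem : J ∈ Finset.Icc J Finset.univ := by simp
    rw [Finset.sum_congr rfl h2, ← Finset.add_sum_erase _ _ hmem, Finset.sum_congr rfl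
      (g := fun _ => 1)] at h1
    · rw [Finset.sum_const, smul_eq_mul, mul_one, Finset.card_erase_of_mem hmem,
        Finset.card_Icc_finset (Finset.subset_univ _), Finset.card_univ, Fintype.card_fin] at h1
      have : 0 < 2 ^ (n - J.card) := by positivity
      omega
    · intro K hK
      obtain ⟨hne, hK⟩ := Finset.mem_erase.1 hK
      have hss : J ⊂ K := lt_of_le_of_ne (Finset.mem_Icc.1 hK).1 hne.symm
      have hc := Finset.card_lt_card hss
      have hc' : K.card ≤ n := by simpa using Finset.card_le_univ K
      exact ih (n - K.card) (by omega) K rfl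
  rw [Function.bijective_iff_existsUnique]
  intro J
  obtain ⟨σ, hσ⟩ := Finset.card_eq_one.1 (hone _ J rfl)
  have h : ∀ τ, D τ = J ↔ τ = σ := fun τ => by
    have := Finset.ext_iff.1 hσ τ
    simpa using this
  exact ⟨σ, (h σ).2 rfl, fun τ hτ => (h τ).1 hτ⟩

/-- Less than a third of the edges of a combinatorial cube of dimension at least six are cut by a
generic functional. -/
lemma three_mul_card_cut_lt {n : ℕ} (hn : 6 ≤ n) {φ : (Fin n → Bool) → ℝ}
    {a : (Fin n → Bool) → Fin n → ℝ} {κ : (Fin n → Bool) → Fin n → Bool → ℝ}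
    (hκ0 : ∀ σ j, κ σ j (σ j) = 0) (hκ : ∀ σ j, κ σ j (!σ j) < 0)
    (hφ : ∀ σ τ, φ τ = φ σ + ∑ j, a σ j * κ τ j (σ j))
    (h0 : ∀ σ, φ σ ≠ 0) (hne : ∀ σ j, φ (flipAt σ j) ≠ φ σ) :
    3 * (Finset.univ.filter fun x : (Fin n → Bool) × Fin n =>
      x.1 x.2 = true ∧ φ x.1 * φ (flipAt x.1 x.2) < 0).card <
    (Finset.univ.filter fun x : (Fin n → Bool) × Fin n => x.1 x.2 = true).card := by
  classical
  have hflip : ∀ σ j, φ (flipAt σ j) = φ σ + a σ j * κ (flipAt σ j) j (σ j) := by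
    intro σ j
    rw [hφ σ (flipAt σ j), Finset.sum_eq_single j]
    · intro i _ hij
      rw [← flipAt_of_ne σ hij, hκ0, mul_zero]
    · simp
  have hneg : ∀ σ j, κ (flipAt σ j) j (σ j) < 0 := by
    intro σ j
    have := hκ (flipAt σ j) j
    rwa [flipAt_same, Bool.not_not] at this
  have hiff : ∀ σ j, φ (flipAt σ j) < φ σ ↔ 0 < a σ j := by
    intro σ j
    rw [hflip, add_lt_iff_neg_left, ← neg_pos, ← mul_neg]
    exact mul_pos_iff_of_pos_right (neg_pos.2 (hneg σ j))
  let D : (Fin n → Bool) → Finset (Fin n) := fun σ =>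
    Finset.univ.filter fun j => φ (flipAt σ j) < φ σ
  have hmemD : ∀ σ j, j ∈ D σ ↔ φ (flipAt σ j) < φ σ := fun σ j => by simp [D]
  have hD : Function.Bijective D := by
    refine bijective_of_unique_sink D fun J τ => ?_
    obtain ⟨σ, hσ, hmax⟩ := (Finset.univ.filter fun σ : Fin n → Bool =>
      ∀ i ∉ J, σ i = τ i).exists_max_image φ ⟨τ, by simp⟩
    have hσ' : ∀ i ∉ J, σ i = τ i := by simpa using hσ
    refine ⟨σ, ⟨hσ', fun j hj => ?_⟩, fun ρ hρ => ?_⟩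
    · rw [hmemD]
      refine lt_of_le_of_ne (hmax _ ?_) (hne σ j)
      simp only [Finset.mem_filter, Finset.mem_univ, true_and]
      intro i hi
      rw [flipAt_of_ne σ (show i ≠ j by rintro rfl; exact hi hj), hσ' i hi]
    · by_contra hρσ
      obtain ⟨i, hi⟩ := Function.ne_iff.1 hρσ
      have hterm : ∀ j, ρ j ≠ σ j → a ρ j * κ σ j (ρ j) < 0 := by
        intro j hj
        have hjJ : j ∈ J := by
          by_contra h
          exact hj ((hρ.1 j h).trans (hσ' j h).symm)
        have h1 : ρ j = !σ j := by
          cases h : σ j <;> cases h' : ρ j <;> simp_all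
        rw [h1]
        exact mul_neg_of_pos_of_neg ((hiff ρ j).1 ((hmemD ρ j).1 (hρ.2 hjJ))) (hκ σ j)
      have hlt : ∑ j, a ρ j * κ σ j (ρ j) < 0 := by
        refine Finset.sum_neg' (fun j _ => ?_) ⟨i, Finset.mem_univ i, hterm i hi⟩
        by_cases h : ρ j = σ j
        · rw [h, hκ0, mul_zero]
        · exact (hterm j h).le
      have h1 := hφ ρ σ
      have h2 : φ ρ ≤ φ σ := hmax ρ (by simpa using hρ.1)
      linarith
  set C := (Finset.univ.filter fun x : (Fin n → Bool) × Fin n =>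
    0 < φ x.1 ∧ φ (flipAt x.1 x.2) < 0).card with hC
  have hCle : C ≤ ∑ K : Finset (Fin n), (2 * K.card - n) := by
    let ε : (Fin n → Bool) × Fin n → ℤ := fun x => if φ (flipAt x.1 x.2) < φ x.1 then 1 else -1
    have hpos : ∑ x ∈ (Finset.univ.filter fun x : (Fin n → Bool) × Fin n =>
        0 < φ x.1 ∧ 0 < φ (flipAt x.1 x.2)), ε x = 0 := by
      refine Finset.sum_involution (fun x _ => flipPerm n x) ?_ ?_ ?_ ?_
      · intro x _
        simp only [ε, flipPerm, Equiv.coe_fn_mk, flipAt_flipAt]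
        rcases lt_or_gt_of_ne (hne x.1 x.2) with h | h
        · rw [if_pos h, if_neg h.not_gt]
          norm_num
        · rw [if_neg h.not_gt, if_pos h]
          norm_num
      · intro x _ _ h
        have h1 := congrFun (congrArg Prod.fst h) x.2
        simp [flipPerm, flipAt_same] at h1
      · intro x hx
        simp only [Finset.mem_filter, Finset.mem_univ, true_and, flipPerm, Equiv.coe_fn_mk,
          flipAt_flipAt] at hx ⊢
        exact hx.symm
      · intro x _
        simp [flipPerm, flipAt_flipAt]
    have hcut : ∑ x ∈ (Finset.univ.filter fun x : (Fin n → Bool) × Fin n =>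
        0 < φ x.1 ∧ φ (flipAt x.1 x.2) < 0), ε x = C := by
      rw [Finset.sum_congr rfl (g := fun _ => (1 : ℤ))]
      · simp [hC]
      · intro x hx
        simp only [Finset.mem_filter, Finset.mem_univ, true_and] at hx
        simp only [ε]
        rw [if_pos (hx.2.trans hx.1)]
    have hsum : ∑ x ∈ (Finset.univ.filter fun x : (Fin n → Bool) × Fin n => 0 < φ x.1), ε x =
        C := by
      rw [← Finset.sum_filter_add_sum_filter_not _
        (fun x : (Fin n → Bool) × Fin n => 0 < φ (flipAt x.1 x.2)), Finset.filter_filter,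
        Finset.filter_filter, hpos, zero_add, ← hcut]
      refine Finset.sum_congr (Finset.filter_congr fun x _ => ?_) fun _ _ => rfl
      exact and_congr_right fun _ => ⟨fun h => lt_of_le_of_ne (not_lt.1 h) (h0 _),
        fun h => h.not_gt⟩
    have hrow : ∀ σ, ∑ j, ε (σ, j) = 2 * (D σ).card - n := by
      intro σ
      have h1 : (D σ).card + (Finset.univ.filter fun j => ¬ φ (flipAt σ j) < φ σ).card = n := by
        simpa using Finset.card_filter_add_card_filter_not
          (s := (Finset.univ : Finset (Fin n))) (fun j => φ (flipAt σ j) < φ σ)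
      simp only [ε]
      rw [Finset.sum_ite]
      simp only [Finset.sum_const, nsmul_eq_mul, mul_one, mul_neg]
      change ((D σ).card : ℤ) + _ = _
      push_cast [← h1]
      ring
    have hsum' : (C : ℤ) = ∑ σ ∈ Finset.univ.filter (fun σ => 0 < φ σ),
        (2 * ((D σ).card : ℤ) - n) := by
      rw [← hsum, ← Finset.sum_congr rfl fun σ _ => hrow σ, ← Finset.sum_product']
      refine Finset.sum_congr ?_ fun _ _ => rfl
      ext x
      simp
    have hle : (C : ℤ) ≤ ((∑ σ : Fin n → Bool, (2 * (D σ).card - n) : ℕ) : ℤ) := by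
      rw [hsum', Nat.cast_sum]
      refine (Finset.sum_le_sum fun σ _ => ?_).trans
        (Finset.sum_le_sum_of_subset_of_nonneg (Finset.filter_subset _ _)
          (f := fun σ => ((2 * (D σ).card - n : ℕ) : ℤ)) fun _ _ _ => by positivity)
      omega
    rw [← Function.Bijective.sum_comp hD fun K => 2 * K.card - n]
    exact_mod_cast hle
  have hall := three_mul_sum_powerset_lt hn
  have hcutall : 2 * C = 2 * (Finset.univ.filter fun x : (Fin n → Bool) × Fin n =>
      x.1 x.2 = true ∧ φ x.1 * φ (flipAt x.1 x.2) < 0).card := by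
    have h1 := card_filter_flip fun x : (Fin n → Bool) × Fin n =>
      0 < φ x.1 ∧ φ (flipAt x.1 x.2) < 0
    have h2 := card_filter_flip fun x : (Fin n → Bool) × Fin n =>
      x.1 x.2 = true ∧ φ x.1 * φ (flipAt x.1 x.2) < 0
    have h3 : (Finset.univ.filter fun x : (Fin n → Bool) × Fin n =>
        φ x.1 * φ (flipAt x.1 x.2) < 0).card = 2 * C := by
      rw [← Finset.card_filter_add_card_filter_not (fun x => 0 < φ x.1), Finset.filter_filter,
        Finset.filter_filter, two_mul]
      congr 1
      · refine congrArg _ (Finset.filter_congr fun x _ => ?_)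
        rw [and_comm]
        exact and_congr_right fun h => ⟨fun h' => not_le.1 fun hc => h'.not_ge (mul_nonneg h.le hc),
          mul_neg_of_pos_of_neg h⟩
      · rw [hC, ← h1]
        refine congrArg _ (Finset.filter_congr fun x _ => ?_)
        simp only [flipPerm, Equiv.coe_fn_mk, flipAt_flipAt, mul_neg_iff]
        constructor
        · rintro ⟨h | h, h'⟩
          · exact absurd h.1 h'
          · exact h.symm
        · exact fun h => ⟨Or.inr h.symm, h.2.not_gt⟩
    rw [← h3, ← Finset.card_filter_add_card_filter_not (fun x => x.1 x.2 = true),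
      Finset.filter_filter, Finset.filter_filter, two_mul]
    congr 1
    · exact congrArg _ (Finset.filter_congr fun x _ => and_comm)
    · rw [← h2]
      refine congrArg _ (Finset.filter_congr fun x _ => ?_)
      simp only [flipPerm, Equiv.coe_fn_mk, flipAt_flipAt, flipAt_same]
      rw [mul_comm, and_comm]
      simp
  have htotal : 2 * (Finset.univ.filter fun x : (Fin n → Bool) × Fin n =>
      x.1 x.2 = true).card = n * 2 ^ n := by
    have h2 := card_filter_flip fun x : (Fin n → Bool) × Fin n => x.1 x.2 = true
    have h3 := Finset.card_filter_add_card_filter_not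
      (s := (Finset.univ : Finset ((Fin n → Bool) × Fin n))) (fun x => x.1 x.2 = true)
    rw [Finset.card_univ, Fintype.card_prod, Fintype.card_fun, Fintype.card_bool,
      Fintype.card_fin, mul_comm] at h3
    rw [← h3, two_mul]
    congr 1
    rw [← h2]
    refine congrArg _ (Finset.filter_congr fun x _ => ?_)
    simp [flipPerm, flipAt_same]
  omega

lemma exists_eq_smul_add_sum {n : ℕ} {c : Euc (n + 1)} {e : Fin n → Euc (n + 1)}
    {f : Euc (n + 1) →ₗ[ℝ] ℝ} {g : Fin n → Euc (n + 1) →ₗ[ℝ] ℝ} (hf : ∀ i, f (e i) = 0)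
    (hc : f c ≠ 0) (hg : ∀ i k, k ≠ i → g i (e k) = 0) (hg' : ∀ i, g i (e i) ≠ 0)
    (w : Euc (n + 1)) : ∃ (β : ℝ) (a : Fin n → ℝ), w = β • c + ∑ i, a i • e i := by
  have hli : LinearIndependent ℝ (Fin.cons c e : Fin (n + 1) → Euc (n + 1)) := by
    rw [Fintype.linearIndependent_iff]
    intro x hx
    simp only [Fin.sum_univ_succ, Fin.cons_zero, Fin.cons_succ] at hx
    have h0 : x 0 = 0 := by
      have := congrArg f hx
      simpa [hf, hc] using this
    refine Fin.cases h0 fun i => ?_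
    have := congrArg (g i) hx
    rw [h0, zero_smul, zero_add, map_sum, Finset.sum_eq_single i] at this
    · simpa [hg'] using this
    · intro k _ hk
      rw [map_smul, hg i k hk, smul_zero]
    · simp
  have hspan := hli.span_eq_top_of_card_eq_finrank (by simp)
  obtain ⟨a, ha⟩ := (Submodule.mem_span_range_iff_exists_fun ℝ).1
    (hspan.symm ▸ Submodule.mem_top : w ∈ _)
  refine ⟨a 0, fun i => a i.succ, ?_⟩
  rw [← ha, Fin.sum_univ_succ]
  simp

/-- Points close to `p` in the relative interior of a cone spanned by points of a convex set. -/
lemma Convex.exists_forall_mem_and_mem_extreme {E ι : Type*} [AddCommGroup E] [Module ℝ E]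
    [Fintype ι] {A : Set E} (hA : Convex ℝ A) {p : E} (hp : p ∈ A) {z : ι → E} (hz : ∀ i, z i ∈ A)
    {c : ι → ℝ} (hc : ∀ i, 0 < c i) :
    ∃ δ₀ : ℝ, 0 < δ₀ ∧ ∀ δ, 0 < δ → δ ≤ δ₀ →
      p + δ • ∑ i, c i • (z i - p) ∈ A ∧
        ∀ B, IsExtreme ℝ A B → p + δ • ∑ i, c i • (z i - p) ∈ B → ∀ i, z i ∈ B := by
  have hS : 0 ≤ ∑ i, c i := Finset.sum_nonneg fun i _ => (hc i).le
  refine ⟨1 / (1 + ∑ i, c i), by positivity, fun δ hδ hδ' => ?_⟩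
  have hle : δ * ∑ i, c i ≤ 1 := by
    rw [le_div_iff₀ (by positivity)] at hδ'
    linarith
  let W : Option ι → ℝ := fun o => o.elim (1 - δ * ∑ i, c i) fun i => δ * c i
  let Z : Option ι → E := fun o => o.elim p z
  have hW : ∀ o ∈ Finset.univ, 0 ≤ W o := by
    rintro (_ | i) _
    · exact sub_nonneg.2 hle
    · exact (mul_pos hδ (hc i)).le
  have hW1 : ∑ o, W o = 1 := by
    simp [W, Fintype.sum_option, Finset.mul_sum]
  have hZ : ∀ o ∈ Finset.univ, Z o ∈ A := by
    rintro (_ | i) _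
    · exact hp
    · exact hz i
  have hx : ∑ o, W o • Z o = p + δ • ∑ i, c i • (z i - p) := by
    simp only [W, Z, Fintype.sum_option, Option.elim, smul_sub, Finset.sum_sub_distrib,
      Finset.smul_sum, smul_smul, sub_smul, one_smul, ← Finset.sum_smul, Finset.mul_sum]
    abel
  rw [← hx]
  exact ⟨hA.sum_mem hW hW1 hZ, fun B hB hxB i =>
    hB.mem_of_sum_mem hA hW hW1 hZ hxB (Finset.mem_univ (some i)) (mul_pos hδ (hc i))⟩

namespace CrossLabelling

variable {d : ℕ} {T : Set (Euc d)} {u : Fin d → Bool → Euc d}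

lemma mem (h : CrossLabelling T u) (i : Fin d) (b : Bool) : u i b ∈ T :=
  (h.vertex i b).subset rfl

lemma label_injective (h : CrossLabelling T u) {i i' : Fin d} {b b' : Bool}
    (heq : u i b = u i' b') : i = i' ∧ b = b' := by
  by_contra hne
  obtain ⟨σ, hσ, hσ'⟩ : ∃ σ : Fin d → Bool, σ i = b ∧ (!σ i') = b' := by
    by_cases hi : i = i'
    · subst hi
      refine ⟨fun _ => b, rfl, ?_⟩
      cases b <;> cases b' <;> simp_all
    · exact ⟨Function.update (fun _ => b) i' (!b'), by simp [hi], by simp⟩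
  obtain ⟨ν, x, -, -, -, h1, h2, -⟩ := h.facet σ
  have h3 := h1 i
  have h4 := h2 i'
  rw [hσ, heq] at h3
  rw [hσ'] at h4
  exact h4.ne h3

lemma eq_of_mem_of_mem_not (h : CrossLabelling T u) {B : Set (Euc d)} (hB : IsExtreme ℝ T B)
    (hBc : Convex ℝ B) {i : Fin d} {b : Bool} (h1 : u i b ∈ B) (h2 : u i (!b) ∈ B) : B = T := by
  cases b
  · exact h.eq_of_antipodal_mem B hB hBc i h2 h1
  · exact h.eq_of_antipodal_mem B hB hBc i h1 h2

lemma relabel (h : CrossLabelling T u) (e : Fin d ≃ Fin d) (s : Bool) :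
    CrossLabelling T fun i b => u (e i) (xor s b) where
  convex := h.convex
  vertex i b := h.vertex _ _
  exists_eq_of_vertex x hx := by
    obtain ⟨i, b, rfl⟩ := h.exists_eq_of_vertex x hx
    exact ⟨e.symm i, xor s b, by simp⟩
  eq_of_antipodal_mem B hB hBc i h1 h2 := by
    refine h.eq_of_mem_of_mem_not hB hBc h1 ?_
    simpa using h2
  facet σ := by
    obtain ⟨ν, x, hx, hmax, hy, h1, h2, h3⟩ := h.facet fun i => xor s (σ (e.symm i))
    refine ⟨ν, x, hx, hmax, hy, fun i => ?_, fun i => ?_, fun B hB hxB i => ?_⟩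
    · simpa using h1 (e i)
    · simpa using h2 (e i)
    · simpa using h3 B hB hxB (e i)

lemma exists_apply_zero_eq {n : ℕ} {T : Set (Euc (n + 1))} {u : Fin (n + 1) → Bool → Euc (n + 1)}
    (h : CrossLabelling T u) {p : Euc (n + 1)} (hp : IsExtreme ℝ T {p}) :
    ∃ u', CrossLabelling T u' ∧ u' 0 true = p := by
  obtain ⟨i, b, rfl⟩ := h.exists_eq_of_vertex p hp
  exact ⟨_, h.relabel (Equiv.swap 0 i) (!b), by simp⟩

end CrossLabelling

/-- Normals of the facets of `T` through the vertex `u 0 true`, indexed by sign vectors. -/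
structure FacetNormals {n : ℕ} (u : Fin (n + 1) → Bool → Euc (n + 1))
    (ν : (Fin n → Bool) → Euc (n + 1) →ₗ[ℝ] ℝ) : Prop where
  apply_eq : ∀ σ i, ν σ (u i.succ (σ i) - u 0 true) = 0
  apply_lt : ∀ σ i, ν σ (u i.succ (!σ i) - u 0 true) < 0
  apply_antipode : ∀ σ, ν σ (u 0 false - u 0 true) = -1

lemma CrossLabelling.exists_facetNormals {n : ℕ} {T : Set (Euc (n + 1))}
    {u : Fin (n + 1) → Bool → Euc (n + 1)} (h : CrossLabelling T u) :
    ∃ ν, FacetNormals u ν := by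
  have : ∀ σ : Fin n → Bool, ∃ ν : Euc (n + 1) →ₗ[ℝ] ℝ,
      (∀ i, ν (u i.succ (σ i) - u 0 true) = 0) ∧ (∀ i, ν (u i.succ (!σ i) - u 0 true) < 0) ∧
        ν (u 0 false - u 0 true) = -1 := by
    intro σ
    obtain ⟨ν, x, -, -, -, h1, h2, -⟩ := h.facet (Fin.cons true σ : Fin (n + 1) → Bool)
    have h10 : ν (u 0 true) = ν x := h1 0
    have h20 : ν (u 0 false) < ν x := h2 0
    have hpos : 0 < ν x - ν (u 0 false) := sub_pos.2 h20
    refine ⟨(ν x - ν (u 0 false))⁻¹ • ν, fun i => ?_, fun i => ?_, ?_⟩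
    · have := h1 i.succ
      rw [Fin.cons_succ] at this
      rw [LinearMap.smul_apply, map_sub, this, h10, sub_self, smul_zero]
    · have := h2 i.succ
      rw [Fin.cons_succ] at this
      rw [LinearMap.smul_apply, map_sub, h10, smul_eq_mul]
      exact mul_neg_of_pos_of_neg (inv_pos.2 hpos) (sub_neg.2 this)
    · rw [LinearMap.smul_apply, map_sub, h10, smul_eq_mul, ← neg_sub (ν x), mul_neg,
        inv_mul_cancel₀ hpos.ne']
  choose ν h1 h2 h3 using this
  exact ⟨ν, h1, h2, h3⟩

namespace FacetNormals

variable {n : ℕ} {u : Fin (n + 1) → Bool → Euc (n + 1)}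
  {ν : (Fin n → Bool) → Euc (n + 1) →ₗ[ℝ] ℝ}

lemma apply_flipAt_of_ne (h : FacetNormals u ν) (σ : Fin n → Bool) {i j : Fin n} (hij : i ≠ j) :
    ν (flipAt σ j) (u i.succ (σ i) - u 0 true) = 0 := by
  have := h.apply_eq (flipAt σ j) i
  rwa [flipAt_of_ne σ hij] at this

lemma apply_flipAt_lt (h : FacetNormals u ν) (σ : Fin n → Bool) (j : Fin n) :
    ν (flipAt σ j) (u j.succ (σ j) - u 0 true) < 0 := by
  have := h.apply_lt (flipAt σ j) j
  rwa [flipAt_same, Bool.not_not] at this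

lemma apply_flipAt_not (h : FacetNormals u ν) (σ : Fin n → Bool) (j : Fin n) :
    ν (flipAt σ j) (u j.succ (!σ j) - u 0 true) = 0 := by
  have := h.apply_eq (flipAt σ j) j
  rwa [flipAt_same] at this

lemma exists_expansion (h : FacetNormals u ν) (σ : Fin n → Bool) {c : Euc (n + 1)}
    (hc : ν σ c ≠ 0) (w : Euc (n + 1)) : ∃ (β : ℝ) (a : Fin n → ℝ),
      w = β • c + ∑ i, a i • (u i.succ (σ i) - u 0 true) :=
  exists_eq_smul_add_sum (g := fun i => ν (flipAt σ i)) (h.apply_eq σ) hc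
    (fun _ _ hk => h.apply_flipAt_of_ne σ hk) (fun i => (h.apply_flipAt_lt σ i).ne) w

lemma three_mul_card_cut_lt (h : FacetNormals u ν) (hn : 6 ≤ n) {w : Euc (n + 1)}
    (h0 : ∀ σ, ν σ w ≠ 0) (hne : ∀ σ j, ν (flipAt σ j) w ≠ ν σ w) :
    3 * (Finset.univ.filter fun x : (Fin n → Bool) × Fin n =>
      x.1 x.2 = true ∧ ν x.1 w * ν (flipAt x.1 x.2) w < 0).card <
    (Finset.univ.filter fun x : (Fin n → Bool) × Fin n => x.1 x.2 = true).card := by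
  have := fun σ => h.exists_expansion σ (c := u 0 false - u 0 true)
    (by rw [h.apply_antipode]; norm_num) w
  choose β a hw using this
  refine _root_.three_mul_card_cut_lt (φ := fun σ => ν σ w) (a := a)
    (κ := fun σ j b => ν σ (u j.succ b - u 0 true)) hn h.apply_eq h.apply_lt
    (fun σ τ => ?_) h0 hne
  have key : ∀ τ, ν τ w = -β σ + ∑ j, a σ j * ν τ (u j.succ (σ j) - u 0 true) := by
    intro τ
    conv_lhs => rw [hw σ]
    rw [map_add, map_smul, h.apply_antipode, map_sum]
    simp
  have h1 := key σ
  simp only [h.apply_eq, mul_zero, Finset.sum_const_zero, add_zero] at h1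
  rw [h1]
  exact key τ

end FacetNormals

/-- The vertices other than `u 0 true` of the ridge in direction `j` of the facet `σ`. -/
def ridge {n : ℕ} (u : Fin (n + 1) → Bool → Euc (n + 1)) (σ : Fin n → Bool) (j : Fin n) :
    Set (Euc (n + 1)) :=
  (fun i : Fin n => u i.succ (σ i)) '' {j}ᶜ

lemma CrossLabelling.ridge_injective {n : ℕ} {T : Set (Euc (n + 1))}
    {u : Fin (n + 1) → Bool → Euc (n + 1)} (h : CrossLabelling T u) {σ σ' : Fin n → Bool}
    {j j' : Fin n} (heq : ridge u σ j = ridge u σ' j') (hσ : σ j = true) (hσ' : σ' j' = true) :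
    σ = σ' ∧ j = j' := by
  have key : ∀ i, i ≠ j → i ≠ j' ∧ σ i = σ' i := by
    intro i hi
    obtain ⟨k, hk, hki⟩ : u i.succ (σ i) ∈ ridge u σ' j' := heq ▸ ⟨i, hi, rfl⟩
    obtain ⟨h1, h2⟩ := h.label_injective hki
    obtain rfl := Fin.succ_injective _ h1
    exact ⟨hk, h2.symm⟩
  have hj : j = j' := by
    by_contra hne
    exact (key j' (Ne.symm hne)).1 rfl
  subst hj
  refine ⟨funext fun i => ?_, rfl⟩
  by_cases hi : i = j
  · rw [hi, hσ, hσ']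
  · exact (key i hi).2

/-- If the facets `σ` and `flipAt σ j` both see `w` on the inner side, then points obtained from `p`
by a small step in direction `w`, corrected towards the ridge, lie in no proper face. -/
lemma CrossLabelling.exists_forall_eq_of_uncut {n : ℕ} {T : Set (Euc (n + 1))}
    {u : Fin (n + 1) → Bool → Euc (n + 1)} {ν : (Fin n → Bool) → Euc (n + 1) →ₗ[ℝ] ℝ}
    (h : CrossLabelling T u) (hν : FacetNormals u ν) {σ : Fin n → Bool} {j : Fin n}
    {w : Euc (n + 1)} (h1 : ν σ w < 0) (h2 : ν (flipAt σ j) w < 0) :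
    ∃ K₀ : ℝ, ∀ K, K₀ ≤ K → ∃ δ₀ : ℝ, 0 < δ₀ ∧ ∀ δ, 0 < δ → δ ≤ δ₀ →
      u 0 true + δ • (w + K • ∑ᶠ g ∈ ridge u σ j, (g - u 0 true)) ∈ T ∧
      ∀ B, IsExtreme ℝ T B → Convex ℝ B →
        u 0 true + δ • (w + K • ∑ᶠ g ∈ ridge u σ j, (g - u 0 true)) ∈ B → B = T := by
  obtain ⟨β, a, hw⟩ := hν.exists_expansion σ (hν.apply_lt σ j).ne w
  have hβ : 0 < β := by
    have h3 := congrArg (ν σ) hw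
    simp only [map_add, map_smul, map_sum, hν.apply_eq, smul_eq_mul, mul_zero,
      Finset.sum_const_zero, add_zero] at h3
    exact pos_of_mul_neg_left (h3 ▸ h1) (hν.apply_lt σ j).le
  have ha : 0 < a j := by
    have h3 := congrArg (ν (flipAt σ j)) hw
    rw [map_add, map_smul, hν.apply_flipAt_not, smul_zero, zero_add, map_sum,
      Finset.sum_eq_single j (fun i _ hij => by
        rw [map_smul, hν.apply_flipAt_of_ne σ hij, smul_zero]) (by simp), map_smul,
      smul_eq_mul] at h3
    exact pos_of_mul_neg_left (h3 ▸ h2) (hν.apply_flipAt_lt σ j).le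
  refine ⟨1 + ∑ i, |a i|, fun K hK => ?_⟩
  let c : Option (Fin n) → ℝ := fun o => o.elim β fun i => a i + if i = j then 0 else K
  let z : Option (Fin n) → Euc (n + 1) := fun o =>
    o.elim (u j.succ (!σ j)) fun i => u i.succ (σ i)
  have hc : ∀ o, 0 < c o := by
    rintro (_ | i)
    · exact hβ
    · change 0 < a i + if i = j then 0 else K
      split_ifs with hi
      · rw [hi, add_zero]
        exact ha
      · have h3 := Finset.single_le_sum (f := fun i => |a i|) (fun i _ => abs_nonneg _)
          (Finset.mem_univ i)
        have h4 := neg_abs_le (a i)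
        linarith
  have hz : ∀ o, z o ∈ T := by
    rintro (_ | i)
    · exact h.mem _ _
    · exact h.mem _ _
  have hsum : w + K • ∑ᶠ g ∈ ridge u σ j, (g - u 0 true) = ∑ o, c o • (z o - u 0 true) := by
    have h3 : ∑ᶠ g ∈ ridge u σ j, (g - u 0 true) =
        ∑ i, if i = j then 0 else (u i.succ (σ i) - u 0 true) := by
      rw [ridge, finsum_mem_image, finsum_eq_sum_of_fintype]
      · refine Finset.sum_congr rfl fun i _ => ?_
        rw [finsum_eq_if]
        by_cases hi : i = j <;> simp [hi]
      · intro i _ k _ hik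
        exact Fin.succ_injective _ (h.label_injective hik).1
    rw [h3, Fintype.sum_option]
    simp only [c, z, Option.elim]
    conv_lhs => rw [hw]
    rw [add_assoc, Finset.smul_sum, ← Finset.sum_add_distrib]
    refine congrArg _ (Finset.sum_congr rfl fun i _ => ?_)
    split_ifs <;> simp [add_smul]
  rw [hsum]
  obtain ⟨δ₀, hδ₀, H⟩ := h.convex.exists_forall_mem_and_mem_extreme (h.mem 0 true) hz hc
  refine ⟨δ₀, hδ₀, fun δ hδ hδ' => ⟨(H δ hδ hδ').1, fun B hB hBc hx => ?_⟩⟩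
  have h4 := (H δ hδ hδ').2 B hB hx
  exact h.eq_of_mem_of_mem_not hB hBc (h4 (some j)) (h4 none)
/-- The tiles `S` around a common vertex `p` of a face-to-face tiling by crosspolytopes, with
labelled vertices. -/
structure VertexStar {n : ℕ} (p : Euc (n + 1)) (S : Finset (Set (Euc (n + 1))))
    (u : Set (Euc (n + 1)) → Fin (n + 1) → Bool → Euc (n + 1)) : Prop where
  labelling : ∀ T ∈ S, CrossLabelling T (u T)
  apply_zero : ∀ T ∈ S, u T 0 true = p
  extreme : ∀ T ∈ S, ∀ T' ∈ S, T ≠ T' → IsExtreme ℝ T (T ∩ T')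
  inter_ne : ∀ T ∈ S, ∀ T' ∈ S, T ≠ T' → T ∩ T' ≠ T
  exists_neighbour : ∀ T ∈ S, ∀ x ∈ T, x ∉ interior T →
    (∀ B, IsExtreme ℝ T B → x ∈ B → p ∈ B) → ∃ T' ∈ S, T' ≠ T ∧ x ∈ T'

namespace VertexStar

variable {n : ℕ} {p : Euc (n + 1)} {S : Finset (Set (Euc (n + 1)))}
  {u : Set (Euc (n + 1)) → Fin (n + 1) → Bool → Euc (n + 1)} {T T' : Set (Euc (n + 1))}

lemma notMem_of_mem (h : VertexStar p S u) (hT : T ∈ S) (hT' : T' ∈ S) (hne : T ≠ T')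
    {i : Fin (n + 1)} {b : Bool} (h1 : u T i b ∈ T') : u T i (!b) ∉ T' := fun h2 =>
  h.inter_ne T hT T' hT' hne <| (h.labelling T hT).eq_of_mem_of_mem_not (h.extreme T hT T' hT' hne)
    ((h.labelling T hT).convex.inter (h.labelling T' hT').convex)
    ⟨(h.labelling T hT).mem _ _, h1⟩ ⟨(h.labelling T hT).mem _ _, h2⟩

lemma exists_facet_neighbour (h : VertexStar p S u) (hT : T ∈ S) (σ : Fin n → Bool) :
    ∃ T' ∈ S, T' ≠ T ∧ ∀ i, u T i.succ (σ i) ∈ T' := by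
  obtain ⟨ν, x, hxT, hmax, ⟨y, hy, hyν⟩, -, -, hB⟩ :=
    (h.labelling T hT).facet (Fin.cons true σ : Fin (n + 1) → Bool)
  have hxint : x ∉ interior T := by
    intro hx
    obtain ⟨m, hm⟩ := (hy.eventually (mem_interior_iff_mem_nhds.1 hx)).exists
    exact (hyν m).not_ge (hmax _ hm)
  obtain ⟨T', hT', hne, hx⟩ := h.exists_neighbour T hT x hxT hxint fun B hBT hxB => by
    have := hB B hBT hxB 0
    rwa [Fin.cons_zero, h.apply_zero T hT] at this
  refine ⟨T', hT', hne, fun i => ?_⟩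
  have := hB _ (h.extreme T hT T' hT' hne.symm) ⟨hxT, hx⟩ i.succ
  rw [Fin.cons_succ] at this
  exact this.2

lemma exists_ridge_eq (h : VertexStar p S u) (hT : T ∈ S) (hT' : T' ∈ S) (hne : T ≠ T')
    {σ : Fin n → Bool} {j : Fin n} (hmem : ∀ i ≠ j, u T i.succ (σ i) ∈ T') :
    ∃ σ' j', σ' j' = true ∧ ridge (u T') σ' j' = ridge (u T) σ j := by
  classical
  have hLT := h.labelling T hT
  have hLT' := h.labelling T' hT'
  have : ∀ i, ∃ (k : Fin n) (b : Bool), i ≠ j → u T i.succ (σ i) = u T' k.succ b := by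
    intro i
    by_cases hij : i = j
    · exact ⟨i, true, fun hi => (hi hij).elim⟩
    have hsub : {u T i.succ (σ i)} ⊆ T ∩ T' :=
      singleton_subset_iff.2 ⟨hLT.mem _ _, hmem i hij⟩
    have hvert : IsExtreme ℝ T' {u T i.succ (σ i)} := by
      have h1 := h.extreme T' hT' T hT hne.symm
      rw [inter_comm] at h1
      exact h1.trans ((hLT.vertex _ _).mono inter_subset_left hsub)
    obtain ⟨k, b, hkb⟩ := hLT'.exists_eq_of_vertex _ hvert
    obtain rfl | ⟨k, rfl⟩ := Fin.eq_zero_or_eq_succ k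
    · exfalso
      cases b
      · refine h.notMem_of_mem hT' hT hne.symm (i := 0) (b := true) ?_ ?_
        · rw [h.apply_zero T' hT', ← h.apply_zero T hT]
          exact hLT.mem _ _
        · rw [Bool.not_true, ← hkb]
          exact hLT.mem _ _
      · rw [h.apply_zero T' hT', ← h.apply_zero T hT] at hkb
        exact Fin.succ_ne_zero _ (hLT.label_injective hkb).1
    · exact ⟨k, b, fun _ => hkb⟩
  choose l b hlb using this
  have hinj : Set.InjOn l {j}ᶜ := by
    intro i hi k hk hik
    have h1 := hlb i hi
    have h2 := hlb k hk
    rw [← hik] at h2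
    by_cases hb : b k = b i
    · rw [hb, ← h1] at h2
      exact (Fin.succ_injective _ (hLT.label_injective h2).1).symm
    · exfalso
      have hb' : b k = !b i := by
        cases h3 : b k <;> cases h4 : b i <;> simp_all
      rw [hb'] at h2
      exact h.notMem_of_mem hT' hT hne.symm (h1 ▸ hLT.mem _ _) (h2 ▸ hLT.mem _ _)
  obtain ⟨j', hj'⟩ : ∃ j', l '' {j}ᶜ = {j'}ᶜ := by
    have h1 : (Finset.image l {j}ᶜ)ᶜ.card = 1 := by
      rw [Finset.card_compl, Finset.card_image_of_injOn (by simpa using hinj), Finset.card_compl,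
        Finset.card_singleton, Fintype.card_fin]
      have := j.pos
      omega
    obtain ⟨j', hj'⟩ := Finset.card_eq_one.1 h1
    refine ⟨j', ?_⟩
    rw [← compl_compl (Finset.image l {j}ᶜ)] at hj'
    have h2 := congrArg (fun s : Finset (Fin n) => (s : Set (Fin n))ᶜ) hj'
    simpa using h2
  have : Nonempty (Fin n) := ⟨j⟩
  refine ⟨Function.update (fun k => b (Function.invFunOn l {j}ᶜ k)) j' true, j', by simp, ?_⟩
  rw [ridge, ← hj', Set.image_image]
  refine Set.image_congr fun i hi => ?_
  have hne' : l i ≠ j' := by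
    have : l i ∈ ({j'}ᶜ : Set (Fin n)) := hj' ▸ Set.mem_image_of_mem l hi
    exact this
  rw [Function.update_of_ne hne', hinj.leftInvOn_invFunOn hi, hlb i hi]

lemma exists_two_neighbours (h : VertexStar p S u) (hT : T ∈ S) (σ : Fin n → Bool) (j : Fin n) :
    ∃ T₁ ∈ S, ∃ T₂ ∈ S, T ≠ T₁ ∧ T ≠ T₂ ∧ T₁ ≠ T₂ ∧
      (∃ σ' j', σ' j' = true ∧ ridge (u T₁) σ' j' = ridge (u T) σ j) ∧
      ∃ σ' j', σ' j' = true ∧ ridge (u T₂) σ' j' = ridge (u T) σ j := by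
  obtain ⟨T₁, hT₁, hne₁, h₁⟩ := h.exists_facet_neighbour hT σ
  obtain ⟨T₂, hT₂, hne₂, h₂⟩ := h.exists_facet_neighbour hT (flipAt σ j)
  refine ⟨T₁, hT₁, T₂, hT₂, hne₁.symm, hne₂.symm, ?_,
    h.exists_ridge_eq hT hT₁ hne₁.symm fun i _ => h₁ i,
    h.exists_ridge_eq hT hT₂ hne₂.symm fun i hi => ?_⟩
  · rintro rfl
    have := h₂ j
    rw [flipAt_same] at this
    exact h.notMem_of_mem hT hT₁ hne₁.symm (h₁ j) this
  · have := h₂ i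
    rwa [flipAt_of_ne σ hi] at this

lemma eq_of_uncut (h : VertexStar p S u) {ν : Set (Euc (n + 1)) → (Fin n → Bool) →
      Euc (n + 1) →ₗ[ℝ] ℝ} (hν : ∀ T ∈ S, FacetNormals (u T) (ν T)) {w : Euc (n + 1)}
    (hT : T ∈ S) (hT' : T' ∈ S) {σ σ' : Fin n → Bool} {j j' : Fin n}
    (hr : ridge (u T) σ j = ridge (u T') σ' j')
    (h1 : ν T σ w < 0) (h2 : ν T (flipAt σ j) w < 0)
    (h1' : ν T' σ' w < 0) (h2' : ν T' (flipAt σ' j') w < 0) : T = T' := by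
  by_contra hne
  obtain ⟨K, hK⟩ := (h.labelling T hT).exists_forall_eq_of_uncut (hν T hT) h1 h2
  obtain ⟨K', hK'⟩ := (h.labelling T' hT').exists_forall_eq_of_uncut (hν T' hT') h1' h2'
  obtain ⟨δ, hδ, H⟩ := hK (max K K') (le_max_left _ _)
  obtain ⟨δ', hδ', H'⟩ := hK' (max K K') (le_max_right _ _)
  have h3 := H (min δ δ') (lt_min hδ hδ') (min_le_left _ _)
  have h4 := H' (min δ δ') (lt_min hδ hδ') (min_le_right _ _)
  rw [← hr, h.apply_zero T' hT', ← h.apply_zero T hT] at h4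
  exact h.inter_ne T hT T' hT' hne (h3.2 _ (h.extreme T hT T' hT' hne)
    ((h.labelling T hT).convex.inter (h.labelling T' hT').convex) ⟨h3.1, h4.1⟩)

lemma exists_generic {ν : Set (Euc (n + 1)) → (Fin n → Bool) → Euc (n + 1) →ₗ[ℝ] ℝ}
    (hν : ∀ T ∈ S, FacetNormals (u T) (ν T)) : ∃ w, ∀ T ∈ S, (∀ σ, ν T σ w ≠ 0) ∧
      ∀ σ j, ν T (flipAt σ j) w ≠ ν T σ w := by
  obtain ⟨w, hw⟩ := Module.Dual.exists_forall_ne_zero_of_forall_exists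
    (f := fun x : (S × (Fin n → Bool)) ⊕ (S × (Fin n → Bool) × Fin n) =>
      x.elim (fun x => ν x.1 x.2) fun x => ν x.1 (flipAt x.2.1 x.2.2) - ν x.1 x.2.1) (by
      rintro (⟨T, σ⟩ | ⟨T, σ, j⟩)
      · refine ⟨_, ne_of_eq_of_ne ((hν T T.2).apply_antipode σ) ?_⟩
        norm_num
      · refine ⟨u T j.succ (σ j) - u T 0 true, ?_⟩
        simp only [Sum.elim_inr, LinearMap.sub_apply, (hν T T.2).apply_eq, sub_zero]
        exact ((hν T T.2).apply_flipAt_lt σ j).ne)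
  refine ⟨w, fun T hT => ⟨fun σ => hw (Sum.inl (⟨T, hT⟩, σ)), fun σ j heq => ?_⟩⟩
  exact hw (Sum.inr (⟨T, hT⟩, σ, j)) (by simp [heq])

lemma not_nonempty (h : VertexStar p S u) (hn : 6 ≤ n) : ¬ S.Nonempty := by
  classical
  intro hS
  have : ∀ T, ∃ ν, T ∈ S → FacetNormals (u T) ν := fun T => by
    by_cases hT : T ∈ S
    · obtain ⟨ν, hν⟩ := (h.labelling T hT).exists_facetNormals
      exact ⟨ν, fun _ => hν⟩
    · exact ⟨0, fun h => (hT h).elim⟩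
  choose ν hν using this
  obtain ⟨w, hw⟩ := exists_generic hν
  let Ω : Finset (Set (Euc (n + 1)) × (Fin n → Bool) × Fin n) :=
    (S ×ˢ Finset.univ).filter fun x => x.2.1 x.2.2 = true
  let r : Set (Euc (n + 1)) × (Fin n → Bool) × Fin n → Set (Euc (n + 1)) := fun x =>
    ridge (u x.1) x.2.1 x.2.2
  let cut : Set (Euc (n + 1)) × (Fin n → Bool) × Fin n → Prop := fun x =>
    ν x.1 x.2.1 w * ν x.1 (flipAt x.2.1 x.2.2) w < 0
  have hmemΩ : ∀ x, x ∈ Ω ↔ x.1 ∈ S ∧ x.2.1 x.2.2 = true := fun x => by simp [Ω]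
  have hr : ∀ x ∈ Ω, ∀ y ∈ Ω, r x = r y → x.1 = y.1 → x = y := by
    rintro ⟨T, σ, j⟩ hx ⟨T', σ', j'⟩ hy hxy (rfl : T = T')
    rw [hmemΩ] at hx hy
    obtain ⟨rfl, rfl⟩ := (h.labelling T hx.1).ridge_injective hxy hx.2 hy.2
    rfl
  have hlt : 3 * (Ω.filter cut).card < Ω.card := by
    have h1 : (Ω.filter cut).card = ∑ T ∈ S, (Finset.univ.filter fun x : (Fin n → Bool) × Fin n =>
        x.1 x.2 = true ∧ ν T x.1 w * ν T (flipAt x.1 x.2) w < 0).card := by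
      rw [Finset.filter_filter, Finset.card_filter, Finset.sum_product]
      exact Finset.sum_congr rfl fun T _ => (Finset.card_filter _ _).symm
    have h2 : Ω.card = ∑ T ∈ S, (Finset.univ.filter fun x : (Fin n → Bool) × Fin n =>
        x.1 x.2 = true).card := by
      rw [Finset.card_filter, Finset.sum_product]
      exact Finset.sum_congr rfl fun T _ => (Finset.card_filter _ _).symm
    rw [h1, h2, Finset.mul_sum]
    exact Finset.sum_lt_sum_of_nonempty hS fun T hT =>
      (hν T hT).three_mul_card_cut_lt hn (hw T hT).1 (hw T hT).2
  have hfiber : ∀ G ∈ Ω.image r, 3 ≤ (Ω.filter fun x => r x = G).card := by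
    intro G hG
    obtain ⟨x, hx, rfl⟩ := Finset.mem_image.1 hG
    obtain ⟨T₁, hT₁, T₂, hT₂, hne₁, hne₂, hne, ⟨σ₁, j₁, hσ₁, hr₁⟩, σ₂, j₂, hσ₂, hr₂⟩ :=
      h.exists_two_neighbours ((hmemΩ x).1 hx).1 x.2.1 x.2.2
    refine Finset.two_lt_card.2 ⟨x, Finset.mem_filter.2 ⟨hx, rfl⟩, (T₁, σ₁, j₁),
      Finset.mem_filter.2 ⟨(hmemΩ _).2 ⟨hT₁, hσ₁⟩, hr₁⟩, (T₂, σ₂, j₂),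
      Finset.mem_filter.2 ⟨(hmemΩ _).2 ⟨hT₂, hσ₂⟩, hr₂⟩, fun heq => hne₁ (congrArg Prod.fst heq),
      fun heq => hne₂ (congrArg Prod.fst heq), fun heq => hne (congrArg Prod.fst heq)⟩
  have huncut : ∀ G, ((Ω.filter fun x => ¬ cut x).filter fun x => r x = G).card ≤ 2 := by
    intro G
    have hone : ∀ v : Euc (n + 1), (Ω.filter fun x => r x = G ∧ ν x.1 x.2.1 v < 0 ∧
        ν x.1 (flipAt x.2.1 x.2.2) v < 0).card ≤ 1 := by
      refine fun v => Finset.card_le_one.2 fun x hx y hy => ?_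
      rw [Finset.mem_filter] at hx hy
      obtain ⟨hx, rfl, hx1, hx2⟩ := hx
      obtain ⟨hy, hyr, hy1, hy2⟩ := hy
      exact hr x hx y hy hyr.symm (h.eq_of_uncut hν ((hmemΩ x).1 hx).1 ((hmemΩ y).1 hy).1
        hyr.symm hx1 hx2 hy1 hy2)
    refine (Finset.card_le_card (t := _ ∪ _) fun x hx => ?_).trans
      ((Finset.card_union_le _ _).trans (add_le_add (hone w) (hone (-w))))
    simp only [Finset.mem_filter, Finset.mem_union, map_neg, neg_lt_zero] at hx ⊢
    obtain ⟨⟨hx, hcut⟩, hG⟩ := hx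
    have hw1 := (hw x.1 ((hmemΩ x).1 hx).1).1
    rcases (hw1 x.2.1).lt_or_gt with h1 | h1
    · refine Or.inl ⟨hx, hG, h1, (hw1 _).lt_or_gt.resolve_right fun h2 => hcut ?_⟩
      exact mul_neg_of_neg_of_pos h1 h2
    · refine Or.inr ⟨hx, hG, h1, (hw1 _).lt_or_gt.resolve_left fun h2 => hcut ?_⟩
      exact mul_neg_of_pos_of_neg h1 h2
  have hle : 3 * (Ω.filter fun x => ¬ cut x).card ≤ 2 * Ω.card := by
    rw [Finset.card_eq_sum_card_image r Ω, Finset.card_eq_sum_card_fiberwise (f := r)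
      (t := Ω.image r) fun x hx => Finset.mem_coe.2
        (Finset.mem_image_of_mem r (Finset.mem_filter.1 hx).1), Finset.mul_sum, Finset.mul_sum]
    refine Finset.sum_le_sum fun G hG => ?_
    have := hfiber G hG
    have := huncut G
    omega
  have := Finset.card_filter_add_card_filter_not (s := Ω) cut
  omega

end VertexStar

section Tiling

variable {d : ℕ} {𝒯 : Set (Set (Euc d))}

lemma LocallyFiniteTiling.exists_ne_mem (hlf : LocallyFiniteTiling 𝒯) (hT : IsTiling 𝒯)
    {T : Set (Euc d)} {x : Euc d} (hx : x ∉ interior T) :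
    ∃ T' ∈ 𝒯, T' ≠ T ∧ x ∈ T' := by
  by_contra! hcon
  have hfin := (hlf _ (isCompact_closedBall x 1)).subset
    (sep_subset {T' ∈ 𝒯 | (T' ∩ Metric.closedBall x 1).Nonempty} fun T' => T' ≠ T)
  have hclosed := hfin.isClosed_biUnion (f := fun T' => T') fun T' hT' => hT.1 T' hT'.1.1
  refine hx (mem_interior_iff_mem_nhds.2 ?_)
  filter_upwards [Metric.closedBall_mem_nhds x one_pos, hclosed.isOpen_compl.mem_nhds (by
    simp only [mem_compl_iff, mem_iUnion, not_exists]
    exact fun T' hT' => hcon T' hT'.1.1 hT'.2)] with y hy hy'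
  obtain ⟨T', hT', hyT'⟩ : y ∈ ⋃₀ 𝒯 := hT.2.1 ▸ mem_univ y
  by_contra hyT
  refine hy' (mem_biUnion (x := T') ⟨⟨hT', ⟨y, hyT', hy⟩⟩, ?_⟩ hyT')
  rintro rfl
  exact hyT hyT'

lemma FaceToFace.inter_ne (hff : FaceToFace 𝒯) {T T' : Set (Euc d)} (hT : T ∈ 𝒯) (hT' : T' ∈ 𝒯)
    (hne : T ≠ T') (hxint : (interior T).Nonempty) : T ∩ T' ≠ T := by
  intro heq
  obtain ⟨x, hx⟩ := hxint
  have h1 := (hff T hT T' hT' hne).2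
  rw [heq] at h1
  exact hne (h1.eq_of_mem_interior (interior_subset hx)
    (interior_mono (inter_eq_left.1 heq) hx))

end Tiling

/-- for `d ≥ 7` the `d`-crosspolytope is a nontile. -/
theorem crosspolytope_is_nontile (d : ℕ) (hd : 7 ≤ d) :
    ¬ ∃ 𝒯 : Set (Set (Euc d)), IsTiling 𝒯 ∧ LocallyFiniteTiling 𝒯 ∧ FaceToFace 𝒯 ∧
        ∀ T ∈ 𝒯, IsConvexPolytope T ∧ CombEquiv T (crossPolytope d) := by
  obtain ⟨n, rfl⟩ : ∃ n, d = n + 1 := ⟨d - 1, by omega⟩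
  rintro ⟨𝒯, htil, hlf, hff, hC⟩
  have hlab := fun T hT => (hC T hT).1.exists_crossLabelling n.succ_ne_zero (hC T hT).2
  obtain ⟨T₀, hT₀, -⟩ : (0 : Euc (n + 1)) ∈ ⋃₀ 𝒯 := htil.2.1 ▸ mem_univ _
  obtain ⟨u₀, hu₀⟩ := hlab T₀ hT₀
  set p := u₀ 0 true with hp
  have hpT₀ : p ∈ T₀ := hu₀.mem _ _
  have hfin : {T ∈ 𝒯 | p ∈ T}.Finite := by
    simpa using hlf {p} isCompact_singleton
  have hvert : ∀ T ∈ 𝒯, p ∈ T → IsExtreme ℝ T {p} := by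
    intro T hT hpT
    by_cases hne : T₀ = T
    · exact hne ▸ hu₀.vertex _ _
    · exact (hff T₀ hT₀ T hT hne).2.trans ((hu₀.vertex 0 true).mono inter_subset_left
        (singleton_subset_iff.2 ⟨hpT₀, hpT⟩))
  have : ∀ T, ∃ u, T ∈ 𝒯 → p ∈ T → CrossLabelling T u ∧ u 0 true = p := by
    intro T
    by_cases hT : T ∈ 𝒯 ∧ p ∈ T
    · obtain ⟨u, hu⟩ := hlab T hT.1
      obtain ⟨u', hu'⟩ := hu.exists_apply_zero_eq (hvert T hT.1 hT.2)
      exact ⟨u', fun _ _ => hu'⟩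
    · exact ⟨u₀, fun h1 h2 => (hT ⟨h1, h2⟩).elim⟩
  choose u hu using this
  have hmem : ∀ T, T ∈ hfin.toFinset ↔ T ∈ 𝒯 ∧ p ∈ T := fun T => by simp
  have hstar : VertexStar p hfin.toFinset u := by
    refine ⟨fun T hT => ?_, fun T hT => ?_, fun T hT T' hT' hne => ?_, fun T hT T' hT' hne => ?_,
      fun T hT x hx hxi hB => ?_⟩ <;> rw [hmem] at hT
    · exact (hu T hT.1 hT.2).1
    · exact (hu T hT.1 hT.2).2
    · exact (hff T hT.1 T' ((hmem T').1 hT').1 hne).1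
    · exact hff.inter_ne hT.1 ((hmem T').1 hT').1 hne (hC T hT.1).1.2
    · obtain ⟨T', hT', hne, hxT'⟩ := hlf.exists_ne_mem htil hxi
      exact ⟨T', (hmem T').2 ⟨hT', (hB _ (hff T hT.1 T' hT' hne.symm).1 ⟨hx, hxT'⟩).2⟩, hne, hxT'⟩
  exact hstar.not_nonempty (by omega) ⟨T₀, (hmem T₀).2 ⟨hT₀, hpT₀⟩⟩
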